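/- Let F be a field and m, n ≥ 1, and let V₂, ⟨·,·⟩ and Sp(V₂) be as in the context. Let N ⊆ Hom(F^m, V₂) be the moment cone of all linear maps whose image is isotropic, and for 0 ≤ k ≤ min(m,n) let N^k = {T ∈ N : rank T = k}. Then each N^k is a single orbit for the action (g₁, g)·T = g ∘ T ∘ g₁⁻¹ of GL_m(F) × Sp(V₂): for any T, T′ ∈ N with rank T = rank T′ there exist g₁ ∈ GL_m(F) and g ∈ Sp(V₂) with T′ = g ∘ T ∘ g₁⁻¹. -/

import Mathlib

open Matrix

/-- The Gram matrix of the symplectic form on `V₂ = F^{2n}` with basis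
`f₁,…,f_n,f_{-n},…,f_{-1}`, determined by `⟨f_i, f_{-i}⟩ = 1 = -⟨f_{-i}, f_i⟩`. -/
def sympForm (F : Type*) [Zero F] [One F] [Neg F] (n : ℕ) :
    Matrix (Fin (2 * n)) (Fin (2 * n)) F :=
  fun a b => if (a : ℕ) + (b : ℕ) + 1 = 2 * n then (if (a : ℕ) < n then 1 else -1) else 0

namespace LinearMap.BilinForm

variable {F V : Type*} [Field F] [AddCommGroup V] [Module F V] {B : LinearMap.BilinForm F V}

/-- A symplectic transvection along `z - u` carries `u` to `z` when `B u z ≠ 0`, and fixes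
every vector orthogonal to `u` and `z`. -/
lemma IsAlt.exists_isometry_apply_eq_of_ne_zero (hB : B.IsAlt) {u z : V} (huz : B u z ≠ 0) :
    ∃ g : V →ₗ[F] V, (∀ x y, B (g x) (g y) = B x y) ∧ g u = z ∧
      ∀ x, B x u = 0 → B x z = 0 → g x = x := by
  refine ⟨LinearMap.id + ((B u z)⁻¹ • B.flip (z - u)).smulRight (z - u), fun x y => ?_, ?_, ?_⟩
  · have hzu : B z u = -B u z := (hB.neg_eq u z).symm
    have hyu : B u y = -B y u := (hB.neg_eq y u).symm
    have hyz : B z y = -B y z := (hB.neg_eq y z).symm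
    simp [hB.self_eq_zero, hzu, hyu, hyz]
    ring
  · simp [hB.self_eq_zero, huz]
  · intro x hu hz
    simp [hu, hz]

/-- If `u` and `w` lie outside a subspace `W`, some vector orthogonal to `W` pairs nontrivially
with both of them. -/
lemma Nondegenerate.exists_mem_orthogonal_ne_zero [FiniteDimensional F V] (hnd : B.Nondegenerate)
    (hB : B.IsRefl) {W : Submodule F V} {u w : V} (hu : u ∉ W) (hw : w ∉ W) :
    ∃ z ∈ B.orthogonal W, B u z ≠ 0 ∧ B w z ≠ 0 := by
  have key : ∀ x ∉ W, ∃ z ∈ B.orthogonal W, B x z ≠ 0 := by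
    intro x hx
    by_contra! h
    refine hx ?_
    rw [← orthogonal_orthogonal hnd hB W, mem_orthogonal_iff]
    exact fun z hz => hB _ _ (h z hz)
  obtain ⟨a, ha, hua⟩ := key u hu
  obtain ⟨b, hb, hwb⟩ := key w hw
  by_cases hwa : B w a = 0
  · by_cases hub : B u b = 0
    · exact ⟨a + b, add_mem ha hb, by simpa [hub], by simpa [hwa]⟩
    · exact ⟨b, hb, hub, hwb⟩
  · exact ⟨a, ha, hua, hwa⟩

/-- The isometries fixing a subspace `W` pointwise act transitively on the vectors orthogonal to
`W` and not contained in it. -/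
lemma IsAlt.exists_isometry_fixing_apply_eq [FiniteDimensional F V] (hB : B.IsAlt)
    (hnd : B.Nondegenerate) {W : Submodule F V} {u w : V} (hu : u ∉ W) (hw : w ∉ W)
    (huW : u ∈ B.orthogonal W) (hwW : w ∈ B.orthogonal W) :
    ∃ g : V →ₗ[F] V, (∀ x y, B (g x) (g y) = B x y) ∧ g u = w ∧ ∀ x ∈ W, g x = x := by
  obtain ⟨z, hzW, huz, hwz⟩ := hnd.exists_mem_orthogonal_ne_zero hB.isRefl hu hw
  have hzw : B z w ≠ 0 := fun h => hwz (hB.isRefl _ _ h)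
  obtain ⟨g, hg, hgu, hgW⟩ := hB.exists_isometry_apply_eq_of_ne_zero huz
  obtain ⟨h, hh, hhz, hhW⟩ := hB.exists_isometry_apply_eq_of_ne_zero hzw
  refine ⟨h ∘ₗ g, fun x y => by simp [hg, hh], by simp [hgu, hhz], fun x hx => ?_⟩
  simp [hgW x (huW x hx) (hzW x hx), hhW x (hzW x hx) (hwW x hx)]

/-- Witt's theorem for isotropic families: two linearly independent isotropic families of the
same size are related by an isometry. -/
theorem IsAlt.exists_isometry_apply_eq [FiniteDimensional F V] (hB : B.IsAlt)
    (hnd : B.Nondegenerate) {k : ℕ} {v w : Fin k → V} (hv : LinearIndependent F v)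
    (hw : LinearIndependent F w) (hvB : ∀ i j, B (v i) (v j) = 0)
    (hwB : ∀ i j, B (w i) (w j) = 0) :
    ∃ g : V →ₗ[F] V, (∀ x y, B (g x) (g y) = B x y) ∧ ∀ i, g (v i) = w i := by
  induction k with
  | zero => exact ⟨LinearMap.id, fun _ _ => rfl, fun i => i.elim0⟩
  | succ k ih =>
    obtain ⟨hw₀, hw₁⟩ := linearIndependent_finSucc'.1 hw
    obtain ⟨g, hg, hgv⟩ := ih (linearIndependent_finSucc'.1 hv).1 hw₀
      (fun i j => hvB _ _) (fun i j => hwB _ _)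
    have hginj : LinearMap.ker g = ⊥ := by
      refine LinearMap.ker_eq_bot'.2 fun x hx => hnd.1 x fun y => ?_
      rw [← hg, hx, map_zero, LinearMap.zero_apply]
    have hinit : Fin.init (g ∘ v) = Fin.init w := funext hgv
    have hu := (linearIndependent_finSucc'.1 (hv.map' g hginj)).2
    rw [hinit] at hu
    have mem_orthogonal {x : V} (hx : ∀ i, B (Fin.init w i) x = 0) :
        x ∈ B.orthogonal (Submodule.span F (Set.range (Fin.init w))) := by
      have hle : Submodule.span F (Set.range (Fin.init w)) ≤ LinearMap.ker (B.flip x) :=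
        Submodule.span_le.2 (Set.range_subset_iff.2 fun i => by simpa using hx i)
      exact fun y hy => by simpa using hle hy
    obtain ⟨h, hh, hhu, hhW⟩ := hB.exists_isometry_fixing_apply_eq hnd hu hw₁
      (mem_orthogonal fun i => by rw [← hgv i, Function.comp_apply, hg]; exact hvB _ _)
      (mem_orthogonal fun i => hwB _ _)
    refine ⟨h ∘ₗ g, fun x y => by simp [hg, hh], fun i => ?_⟩
    induction i using Fin.lastCases with
    | last => exact hhu
    | cast i =>
      have hi : g (v i.castSucc) = w i.castSucc := hgv i
      rw [LinearMap.comp_apply, hi]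
      exact hhW _ (Submodule.subset_span ⟨i, rfl⟩)

/-- Isotropic subspaces of the same dimension are related by an isometry. -/
theorem IsAlt.exists_isometry_map_eq [FiniteDimensional F V] (hB : B.IsAlt)
    (hnd : B.Nondegenerate) {U U' : Submodule F V}
    (hU : ∀ x ∈ U, ∀ y ∈ U, B x y = 0) (hU' : ∀ x ∈ U', ∀ y ∈ U', B x y = 0)
    (hdim : Module.finrank F U = Module.finrank F U') :
    ∃ g : V →ₗ[F] V, (∀ x y, B (g x) (g y) = B x y) ∧ U.map g = U' := by
  have span_range {k : ℕ} {U : Submodule F V} (b : Module.Basis (Fin k) F U) :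
      Submodule.span F (Set.range (fun i => (b i : V))) = U := by
    rw [show (fun i => (b i : V)) = U.subtype ∘ b from rfl, Set.range_comp, Submodule.span_image,
      b.span_eq, Submodule.map_top, Submodule.range_subtype]
  let b := Module.finBasis F U
  let b' := (Module.finBasis F U').reindex (finCongr hdim.symm)
  obtain ⟨g, hg, hgb⟩ := hB.exists_isometry_apply_eq hnd
    (v := fun i => (b i : V)) (w := fun i => (b' i : V))
    (b.linearIndependent.map' U.subtype U.ker_subtype)
    (b'.linearIndependent.map' U'.subtype U'.ker_subtype)
    (fun i j => hU _ (b i).2 _ (b j).2) (fun i j => hU' _ (b' i).2 _ (b' j).2)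
  refine ⟨g, hg, ?_⟩
  rw [← span_range b, Submodule.map_span, ← Set.range_comp, ← span_range b']
  exact congrArg _ (congrArg _ (funext hgb))

end LinearMap.BilinForm

/-- Linear maps out of a finite-dimensional space with the same range differ by an automorphism
of the source. -/
lemma LinearMap.exists_linearEquiv_comp_eq_of_range_eq {F V W : Type*} [Field F]
    [AddCommGroup V] [Module F V] [FiniteDimensional F V] [AddCommGroup W] [Module F W]
    {f f' : V →ₗ[F] W} (h : LinearMap.range f = LinearMap.range f') :
    ∃ e : V ≃ₗ[F] V, f' ∘ₗ e = f := by
  obtain ⟨C, hC⟩ := (LinearMap.ker f).exists_isCompl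
  obtain ⟨C', hC'⟩ := (LinearMap.ker f').exists_isCompl
  have hker : Module.finrank F (LinearMap.ker f) = Module.finrank F (LinearMap.ker f') := by
    have h₁ := f.finrank_range_add_finrank_ker
    have h₂ := f'.finrank_range_add_finrank_ker
    rw [h] at h₁
    omega
  let eC : C ≃ₗ[F] C' := f.kerComplementEquivRange hC.symm ≪≫ₗ
    LinearEquiv.ofEq _ _ h ≪≫ₗ (f'.kerComplementEquivRange hC'.symm).symm
  have heC (c : C) : f' (eC c) = f c := by
    have := congrArg Subtype.val ((f'.kerComplementEquivRange hC'.symm).apply_symm_apply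
      (LinearEquiv.ofEq _ _ h (f.kerComplementEquivRange hC.symm c)))
    exact this
  let s := Submodule.prodEquivOfIsCompl _ _ hC
  let s' := Submodule.prodEquivOfIsCompl _ _ hC'
  refine ⟨s.symm ≪≫ₗ (LinearEquiv.ofFinrankEq _ _ hker).prodCongr eC ≪≫ₗ s', ?_⟩
  ext x
  obtain ⟨⟨a, c⟩, rfl⟩ := s.surjective x
  simp [s, s', heC]

section SympForm

variable {F : Type*} [Field F] {n : ℕ}

lemma sympForm_mulVec (v : Fin (2 * n) → F) (a : Fin (2 * n)) :
    (sympForm F n *ᵥ v) a = (if (a : ℕ) < n then 1 else -1) * v a.rev := by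
  rw [Matrix.mulVec, dotProduct, Finset.sum_eq_single a.rev]
  · rw [sympForm, if_pos (by rw [Fin.val_rev]; omega)]
  · intro b _ hb
    rw [sympForm, if_neg (fun h => hb (Fin.ext (by rw [Fin.val_rev]; omega))), zero_mul]
  · simp

lemma sympForm_mulVec_injective : Function.Injective (sympForm F n).mulVec := by
  intro v w h
  ext a
  have ha := congrFun h a.rev
  simp only [sympForm_mulVec, Fin.rev_rev] at ha
  split_ifs at ha <;> simpa using ha

lemma isUnit_det_sympForm : IsUnit (sympForm F n).det :=
  (Matrix.isUnit_iff_isUnit_det _).1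
    (Matrix.mulVec_injective_iff_isUnit.1 sympForm_mulVec_injective)

lemma sympForm_toBilin'_isAlt : (Matrix.toBilin' (sympForm F n)).IsAlt := by
  intro v
  rw [Matrix.toBilin'_apply', dotProduct]
  simp only [sympForm_mulVec]
  refine Finset.sum_involution (fun a _ => a.rev) (fun a _ => ?_) (fun a _ _ h => ?_)
    (fun _ _ => Finset.mem_univ _) (fun a _ => Fin.rev_rev a)
  · have ha := a.isLt
    rw [Fin.rev_rev, Fin.val_rev]
    split_ifs
    · omega
    · ring
    · ring
    · omega
  · have := congrArg Fin.val h
    rw [Fin.val_rev] at this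
    omega

lemma toBilin'_mulVec_mulVec {ι κ : Type*} [Fintype ι] [DecidableEq ι] [Fintype κ]
    [DecidableEq κ] (M : Matrix ι ι F) (A : Matrix ι κ F) (x y : κ → F) :
    Matrix.toBilin' M (A *ᵥ x) (A *ᵥ y) = Matrix.toBilin' (Aᵀ * M * A) x y := by
  simp [← Matrix.toBilin'_comp]

end SympForm

/-- Each stratum `N^k` of maps with isotropic image and fixed rank `k` in the moment cone
`N ⊆ Hom(F^m, V₂)` is a single `GL_m(F) × Sp(V₂)`-orbit: if `T, T'` both have isotropic
image and equal rank, then `T' = g ∘ T ∘ g₁⁻¹` for some `g₁ ∈ GL_m(F)` and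
`g ∈ Sp(V₂)`. -/
theorem momentCone_rank_stratum_is_single_orbit (F : Type*) [Field F] (m n : ℕ)
    (hm : 1 ≤ m) (hn : 1 ≤ n)
    (T T' : Matrix (Fin (2 * n)) (Fin m) F)
    (hT : Tᵀ * sympForm F n * T = 0) (hT' : T'ᵀ * sympForm F n * T' = 0)
    (hrank : T.rank = T'.rank) :
    ∃ (g₁ : Matrix (Fin m) (Fin m) F) (g : Matrix (Fin (2 * n)) (Fin (2 * n)) F),
      IsUnit g₁ ∧ IsUnit g ∧ gᵀ * sympForm F n * g = sympForm F n ∧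
      T' = g * T * g₁⁻¹ := by
  have isotropic (S : Matrix (Fin (2 * n)) (Fin m) F) (hS : Sᵀ * sympForm F n * S = 0) :
      ∀ x ∈ LinearMap.range S.mulVecLin, ∀ y ∈ LinearMap.range S.mulVecLin,
        Matrix.toBilin' (sympForm F n) x y = 0 := by
    rintro _ ⟨x, rfl⟩ _ ⟨y, rfl⟩
    simp only [Matrix.mulVecLin_apply, toBilin'_mulVec_mulVec, hS, map_zero, LinearMap.zero_apply]
  obtain ⟨g, hg, hmap⟩ := sympForm_toBilin'_isAlt.exists_isometry_map_eq
    (LinearMap.BilinForm.nondegenerate_toBilin'_of_det_ne_zero' _ isUnit_det_sympForm.ne_zero)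
    (isotropic T hT) (isotropic T' hT') hrank
  rw [← LinearMap.range_comp] at hmap
  obtain ⟨e, he⟩ := LinearMap.exists_linearEquiv_comp_eq_of_range_eq hmap
  have hgJ : (LinearMap.toMatrix' g)ᵀ * sympForm F n * LinearMap.toMatrix' g = sympForm F n := by
    apply Matrix.toBilin'.injective
    refine LinearMap.ext₂ fun x y => ?_
    rw [← toBilin'_mulVec_mulVec, LinearMap.toMatrix'_mulVec, LinearMap.toMatrix'_mulVec, hg]
  have hunit : IsUnit (LinearMap.toMatrix' e.toLinearMap) :=
    LinearMap.isUnit_toMatrix'_iff.2 ((Module.End.isUnit_iff _).2 e.bijective)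
  refine ⟨LinearMap.toMatrix' e.toLinearMap, LinearMap.toMatrix' g, hunit, ?_, hgJ, ?_⟩
  · have hdet := congrArg Matrix.det hgJ
    rw [Matrix.det_mul] at hdet
    rw [Matrix.isUnit_iff_isUnit_det]
    exact isUnit_of_mul_isUnit_right (hdet ▸ isUnit_det_sympForm)
  · have hmat := congrArg LinearMap.toMatrix' he
    rw [LinearMap.toMatrix'_comp, LinearMap.toMatrix'_comp, ← Matrix.toLin'_apply',
      ← Matrix.toLin'_apply', LinearMap.toMatrix'_toLin', LinearMap.toMatrix'_toLin'] at hmat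
    rw [← hmat, Matrix.mul_assoc, Matrix.mul_nonsing_inv _
      ((Matrix.isUnit_iff_isUnit_det _).1 hunit), Matrix.mul_one]
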